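/- Let 𝔅' ⊆ 𝔅(X) be nonempty with the forward exchange property. Then for every k ≥ 0, the dimension of the degree-k homogeneous component of 𝒫(X,𝔅') equals the dimension of the degree-k homogeneous component of 𝒟(X,𝔅'), and both equal the number of bases B ∈ 𝔅' with |E(B)| = N − r − k. -/

import Mathlib

noncomputable section

variable {r N : ℕ}

/-- `p_u`, the degree-one polynomial associated with the vector `u ∈ ℝ^r`. -/
def linPoly {r : ℕ} (u : Fin r → ℝ) : MvPolynomial (Fin r) ℝ :=
  ∑ i, MvPolynomial.C (u i) * MvPolynomial.X i

/-- `p_Y = ∏_{i ∈ Y} p_{X i}` for a sublist `Y` of the list `X`. -/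
def prodPoly {r N : ℕ} (X : Fin N → Fin r → ℝ) (Y : Finset (Fin N)) : MvPolynomial (Fin r) ℝ :=
  ∏ i ∈ Y, linPoly (X i)

/-- The pairing `⟨p, f⟩ = (p(∂/∂t₁,…,∂/∂t_r) f)(0)`, written via coefficients:
`⟨p,f⟩ = ∑_α α! · p_α · f_α`. -/
def pairing {r : ℕ} (p f : MvPolynomial (Fin r) ℝ) : ℝ :=
  ∑ α ∈ p.support, (∏ i, ((α i).factorial : ℝ)) * p.coeff α * f.coeff α

lemma pairing_zero {r : ℕ} (q : MvPolynomial (Fin r) ℝ) : pairing q 0 = 0 := by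
  simp [pairing]

lemma pairing_add {r : ℕ} (q f g : MvPolynomial (Fin r) ℝ) :
    pairing q (f + g) = pairing q f + pairing q g := by
  unfold pairing
  rw [← Finset.sum_add_distrib]
  exact Finset.sum_congr rfl fun α _ => by rw [MvPolynomial.coeff_add]; ring

lemma pairing_smul {r : ℕ} (q : MvPolynomial (Fin r) ℝ) (c : ℝ) (f : MvPolynomial (Fin r) ℝ) :
    pairing q (c • f) = c * pairing q f := by
  unfold pairing
  rw [Finset.mul_sum]
  exact Finset.sum_congr rfl fun α _ => by rw [MvPolynomial.coeff_smul, smul_eq_mul]; ring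

/-- The kernel (Macaulay inverse system) of an ideal `I`:
all polynomials annihilated (in the sense of the pairing) by every element of `I`. -/
def kerIdeal {r : ℕ} (I : Ideal (MvPolynomial (Fin r) ℝ)) :
    Submodule ℝ (MvPolynomial (Fin r) ℝ) where
  carrier := {f | ∀ q ∈ I, pairing q f = 0}
  add_mem' := fun hf hg q hq => by
    rw [pairing_add, hf q hq, hg q hq, add_zero]
  zero_mem' := fun q _ => pairing_zero q
  smul_mem' := fun c f hf q hq => by
    rw [pairing_smul, hf q hq, mul_zero]

section Lists

variable {M : Type*} [AddCommGroup M] [Module ℝ M]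

/-- `B ⊆ G` is (the index set of) a sublist of the list `v` restricted to the ground set `G`
that is a basis of the ambient space. -/
def basesOn (v : Fin N → M) (G : Finset (Fin N)) : Set (Finset (Fin N)) :=
  {B | B ⊆ G ∧ LinearIndependent ℝ ((B : Set (Fin N)).restrict v) ∧
    Submodule.span ℝ (v '' (B : Set (Fin N))) = ⊤}

/-- `j` is externally active with respect to the basis `B`:
`v j ∈ span {v e : e ∈ B, e ≤ j}` and `j ∉ B`. -/
def isExtActive (v : Fin N → M) (B : Finset (Fin N)) (j : Fin N) : Prop :=
  j ∉ B ∧ v j ∈ Submodule.span ℝ (v '' {e : Fin N | e ∈ B ∧ e ≤ j})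

open Classical in
/-- The set `E(B)` of externally active elements (within the ground set `G`). -/
def extSetOn (v : Fin N → M) (G B : Finset (Fin N)) : Finset (Fin N) :=
  G.filter (fun j => isExtActive v B j)

/-- `C` is a cocircuit w.r.t. the collection of bases `𝔅`: an inclusion-minimal
sublist of the ground set `G` intersecting every basis in `𝔅`. -/
def isCocircuitOn (G : Finset (Fin N)) (𝔅 : Set (Finset (Fin N))) (C : Finset (Fin N)) : Prop :=
  C ⊆ G ∧ (∀ B ∈ 𝔅, (C ∩ B).Nonempty) ∧
    ∀ C' ⊆ C, (∀ B ∈ 𝔅, (C' ∩ B).Nonempty) → C' = C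

/-- A set of bases `𝔅` of the list `v` has the forward exchange property. -/
def forwardExchange (v : Fin N → M) (𝔅 : Set (Finset (Fin N))) : Prop :=
  ∀ B ∈ 𝔅, ∀ b ∈ B, ∀ j : Fin N,
    v j ∈ Submodule.span ℝ (v '' {e : Fin N | e ∈ B ∧ e ≤ b}) →
    v j ∉ Submodule.span ℝ (v '' {e : Fin N | e ∈ B ∧ e < b}) →
    ¬ isExtActive v B j →
    insert j (B.erase b) ∈ 𝔅

end Lists

/-- The ideal `𝒥` generated by the cocircuit polynomials `p_C`. -/
def Jideal (X : Fin N → Fin r → ℝ) (G : Finset (Fin N)) (𝔅 : Set (Finset (Fin N))) :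
    Ideal (MvPolynomial (Fin r) ℝ) :=
  Ideal.span {p | ∃ C : Finset (Fin N), isCocircuitOn G 𝔅 C ∧ p = prodPoly X C}

/-- The generalised `𝒟`-space: the kernel of the cocircuit ideal. -/
def Dspace (X : Fin N → Fin r → ℝ) (G : Finset (Fin N)) (𝔅 : Set (Finset (Fin N))) :
    Submodule ℝ (MvPolynomial (Fin r) ℝ) :=
  kerIdeal (Jideal X G 𝔅)

/-- `Q_B := p_{X∖(B ∪ E(B))}` (within the ground set `G`). -/
def QB (X : Fin N → Fin r → ℝ) (G B : Finset (Fin N)) : MvPolynomial (Fin r) ℝ :=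
  prodPoly X (G \ (B ∪ extSetOn X G B))

/-- The central `𝒫`-space: the span of `p_Y` over sublists `Y` of `G` whose complement spans. -/
def PspaceOn (X : Fin N → Fin r → ℝ) (G : Finset (Fin N)) :
    Submodule ℝ (MvPolynomial (Fin r) ℝ) :=
  Submodule.span ℝ {p | ∃ Y : Finset (Fin N), Y ⊆ G ∧
    Submodule.span ℝ (X '' ((G \ Y : Finset (Fin N)) : Set (Fin N))) = ⊤ ∧ p = prodPoly X Y}

/-- The generalised `𝒫`-space `𝒫(X,𝔅') = span {Q_B : B ∈ 𝔅'}`. -/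
def PspaceB (X : Fin N → Fin r → ℝ) (G : Finset (Fin N)) (𝔅 : Set (Finset (Fin N))) :
    Submodule ℝ (MvPolynomial (Fin r) ℝ) :=
  Submodule.span ℝ {p | ∃ B ∈ 𝔅, p = QB X G B}

/-- The directional derivative `D_u = ∑ i, uᵢ ∂/∂tᵢ` as a linear map. -/
def dirDeriv {r : ℕ} (u : Fin r → ℝ) :
    MvPolynomial (Fin r) ℝ →ₗ[ℝ] MvPolynomial (Fin r) ℝ :=
  ∑ i, u i • (MvPolynomial.pderiv i).toLinearMap

end

section DegreeFiltration

/-- The polynomials all of whose monomials have degree less than `k`. -/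
def lowDegree (r k : ℕ) : Submodule ℝ (MvPolynomial (Fin r) ℝ) where
  carrier := {f | ∀ m : Fin r →₀ ℕ, k ≤ m.degree → f.coeff m = 0}
  add_mem' := fun hf hg m hm => by rw [MvPolynomial.coeff_add, hf m hm, hg m hm, add_zero]
  zero_mem' := fun m _ => MvPolynomial.coeff_zero m
  smul_mem' := fun c f hf m hm => by rw [MvPolynomial.coeff_smul, hf m hm, smul_zero]

lemma lowDegree_mono (r : ℕ) {j k : ℕ} (h : j ≤ k) : lowDegree r j ≤ lowDegree r k :=
  fun _ hf m hm => hf m (h.trans hm)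

lemma isHomogeneous_mem_lowDegree {r n : ℕ} {f : MvPolynomial (Fin r) ℝ}
    (hf : f.IsHomogeneous n) : f ∈ lowDegree r (n + 1) :=
  fun m hm => hf.coeff_eq_zero (by omega)

lemma isHomogeneous_mul_mem_lowDegree {r j n : ℕ} {f g : MvPolynomial (Fin r) ℝ}
    (hf : f.IsHomogeneous j) (hg : g ∈ lowDegree r n) : f * g ∈ lowDegree r (j + n) := by
  intro m hm
  rw [MvPolynomial.coeff_mul]
  refine Finset.sum_eq_zero fun x hx => ?_
  rw [Finset.HasAntidiagonal.mem_antidiagonal] at hx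
  by_cases h : x.1.degree = j
  · have : n ≤ x.2.degree := by
      rw [← hx, map_add, h] at hm
      omega
    rw [hg _ this, mul_zero]
  · rw [hf.coeff_eq_zero h, zero_mul]

lemma lowDegree_le_of_monomial_mem {r k : ℕ} {S : Submodule ℝ (MvPolynomial (Fin r) ℝ)}
    (h : ∀ m : Fin r →₀ ℕ, m.degree < k → MvPolynomial.monomial m 1 ∈ S) :
    lowDegree r k ≤ S := by
  intro f hf
  rw [f.as_sum]
  refine Submodule.sum_mem _ fun m hm => ?_
  rw [← mul_one (f.coeff m), ← smul_eq_mul, ← MvPolynomial.smul_monomial]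
  refine S.smul_mem _ (h m ?_)
  by_contra hlt
  exact MvPolynomial.mem_support_iff.mp hm (hf m (not_lt.mp hlt))

end DegreeFiltration

section LinearForms

lemma linPoly_add {r : ℕ} (u w : Fin r → ℝ) : linPoly (u + w) = linPoly u + linPoly w := by
  simp [linPoly, add_mul, Finset.sum_add_distrib]

lemma linPoly_smul {r : ℕ} (c : ℝ) (u : Fin r → ℝ) : linPoly (c • u) = c • linPoly u := by
  simp [linPoly, MvPolynomial.smul_eq_C_mul, Finset.mul_sum, mul_assoc]

lemma linPoly_single {r : ℕ} (i : Fin r) : linPoly (Pi.single i 1) = MvPolynomial.X i := by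
  classical
  unfold linPoly
  rw [Finset.sum_eq_single i]
  · simp
  · intro j _ hj
    simp [hj]
  · simp

lemma isHomogeneous_linPoly {r : ℕ} (u : Fin r → ℝ) : (linPoly u).IsHomogeneous 1 :=
  MvPolynomial.IsHomogeneous.sum _ _ _ fun i _ => MvPolynomial.isHomogeneous_C_mul_X (u i) i

lemma eval_linPoly {r : ℕ} (u θ : Fin r → ℝ) : MvPolynomial.eval θ (linPoly u) = u ⬝ᵥ θ := by
  simp [linPoly, dotProduct]

lemma isHomogeneous_prodPoly {r N : ℕ} (X : Fin N → Fin r → ℝ) (Y : Finset (Fin N)) :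
    (prodPoly X Y).IsHomogeneous Y.card := by
  have := MvPolynomial.IsHomogeneous.prod Y (fun i => linPoly (X i)) (fun _ => 1)
    fun i _ => isHomogeneous_linPoly (X i)
  simpa [prodPoly] using this

/-- To multiply by an arbitrary linear form within a subspace, it is enough to multiply by
linear forms coming from a spanning set. -/
lemma linPoly_mul_mem {r : ℕ} {S : Submodule ℝ (MvPolynomial (Fin r) ℝ)}
    {P : MvPolynomial (Fin r) ℝ} {s : Set (Fin r → ℝ)} (h : ∀ u ∈ s, linPoly u * P ∈ S)
    {u : Fin r → ℝ} (hu : u ∈ Submodule.span ℝ s) : linPoly u * P ∈ S := by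
  induction hu using Submodule.span_induction with
  | mem u hu => exact h u hu
  | zero =>
    have : linPoly (0 : Fin r → ℝ) = 0 := by simp [linPoly]
    rw [this, zero_mul]
    exact S.zero_mem
  | add u w _ _ hu hw =>
    rw [linPoly_add, add_mul]
    exact S.add_mem hu hw
  | smul c u _ hu =>
    rw [linPoly_smul, smul_mul_assoc]
    exact S.smul_mem c hu

end LinearForms

section AffineDeformation

variable {r N : ℕ}

/-- The product over `Y` of the affine forms `p_{X i} - lam i`. -/
noncomputable def affProd (X : Fin N → Fin r → ℝ) (lam : Fin N → ℝ) (Y : Finset (Fin N)) :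
    MvPolynomial (Fin r) ℝ :=
  ∏ i ∈ Y, (linPoly (X i) - MvPolynomial.C (lam i))

/-- The ideal generated by the products `affProd X lam C` with `C` meeting every member of `𝔅`. -/
noncomputable def affIdeal (X : Fin N → Fin r → ℝ) (lam : Fin N → ℝ) (𝔅 : Set (Finset (Fin N))) :
    Ideal (MvPolynomial (Fin r) ℝ) :=
  Ideal.span {p | ∃ C : Finset (Fin N), (∀ B ∈ 𝔅, (C ∩ B).Nonempty) ∧ p = affProd X lam C}

/-- The elements that are neither in `B` nor externally active with respect to `B`. -/
noncomputable def passiveSet (X : Fin N → Fin r → ℝ) (B : Finset (Fin N)) : Finset (Fin N) :=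
  Finset.univ \ (B ∪ extSetOn X Finset.univ B)

/-- The span of the deformed `Q_B` of degree less than `k`, plus the deformed cocircuit ideal. -/
noncomputable def affFiltration (X : Fin N → Fin r → ℝ) (lam : Fin N → ℝ) (𝔅 : Set (Finset (Fin N)))
    (k : ℕ) : Submodule ℝ (MvPolynomial (Fin r) ℝ) :=
  Submodule.span ℝ ((fun B => affProd X lam (passiveSet X B)) ''
      {B | B ∈ 𝔅 ∧ (passiveSet X B).card < k}) ⊔
    (affIdeal X lam 𝔅).restrictScalars ℝ

lemma affProd_zero (X : Fin N → Fin r → ℝ) (Y : Finset (Fin N)) :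
    affProd X 0 Y = prodPoly X Y := by
  simp [affProd, prodPoly]

lemma affProd_insert (X : Fin N → Fin r → ℝ) (lam : Fin N → ℝ) {Y : Finset (Fin N)} {i : Fin N}
    (hi : i ∉ Y) :
    affProd X lam (insert i Y) = linPoly (X i) * affProd X lam Y - lam i • affProd X lam Y := by
  rw [affProd, Finset.prod_insert hi, sub_mul, MvPolynomial.smul_eq_C_mul]
  rfl

lemma linPoly_mul_affProd (X : Fin N → Fin r → ℝ) (lam : Fin N → ℝ) {Y : Finset (Fin N)}
    {i : Fin N} (hi : i ∉ Y) :
    linPoly (X i) * affProd X lam Y = affProd X lam (insert i Y) + lam i • affProd X lam Y := by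
  rw [affProd_insert X lam hi, sub_add_cancel]

lemma affProd_sub_prodPoly_mem (X : Fin N → Fin r → ℝ) (lam : Fin N → ℝ) (Y : Finset (Fin N)) :
    affProd X lam Y - prodPoly X Y ∈ lowDegree r Y.card := by
  induction Y using Finset.induction_on with
  | empty => simp [affProd, prodPoly]
  | insert i Y hi ih =>
    have hprod : prodPoly X (insert i Y) = linPoly (X i) * prodPoly X Y := Finset.prod_insert hi
    have hsplit : affProd X lam (insert i Y) - prodPoly X (insert i Y) =
        linPoly (X i) * (affProd X lam Y - prodPoly X Y) - lam i •
          ((affProd X lam Y - prodPoly X Y) + prodPoly X Y) := by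
      rw [affProd_insert X lam hi, hprod, mul_sub, sub_add_cancel]
      abel
    rw [hsplit, Finset.card_insert_of_notMem hi]
    refine Submodule.sub_mem _ ?_ (Submodule.smul_mem _ _ (Submodule.add_mem _ ?_ ?_))
    · rw [add_comm Y.card]
      exact isHomogeneous_mul_mem_lowDegree (isHomogeneous_linPoly _) ih
    · exact lowDegree_mono r (Nat.le_succ _) ih
    · exact isHomogeneous_mem_lowDegree (isHomogeneous_prodPoly X Y)

lemma QB_eq (X : Fin N → Fin r → ℝ) (B : Finset (Fin N)) :
    QB X Finset.univ B = prodPoly X (passiveSet X B) := rfl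

lemma mem_passiveSet {X : Fin N → Fin r → ℝ} {B : Finset (Fin N)} {i : Fin N} :
    i ∈ passiveSet X B ↔ i ∉ B ∧ ¬ isExtActive X B i := by
  simp [passiveSet, extSetOn]

lemma affFiltration_mono (X : Fin N → Fin r → ℝ) (lam : Fin N → ℝ) (𝔅 : Set (Finset (Fin N)))
    {j k : ℕ} (h : j ≤ k) : affFiltration X lam 𝔅 j ≤ affFiltration X lam 𝔅 k :=
  sup_le_sup_right (Submodule.span_mono (Set.image_mono (by exact fun _ hB => ⟨hB.1, hB.2.trans_le h⟩))) _

lemma affIdeal_le_affFiltration {X : Fin N → Fin r → ℝ} {lam : Fin N → ℝ}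
    {𝔅 : Set (Finset (Fin N))} {f : MvPolynomial (Fin r) ℝ} (hf : f ∈ affIdeal X lam 𝔅) (k : ℕ) :
    f ∈ affFiltration X lam 𝔅 k :=
  Submodule.mem_sup_right hf

lemma affProd_passiveSet_mem (X : Fin N → Fin r → ℝ) (lam : Fin N → ℝ)
    {𝔅 : Set (Finset (Fin N))} {B : Finset (Fin N)} (hB : B ∈ 𝔅) {k : ℕ}
    (hk : (passiveSet X B).card < k) :
    affProd X lam (passiveSet X B) ∈ affFiltration X lam 𝔅 k :=
  Submodule.mem_sup_left (Submodule.subset_span ⟨B, ⟨hB, hk⟩, rfl⟩)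

/-- If `x` is passive with respect to a basis `B`, then it can be exchanged with a later
element of `B` in the sense of the forward exchange property. -/
lemma exists_forward_exchange {X : Fin N → Fin r → ℝ} {𝔅 : Set (Finset (Fin N))}
    (hfe : forwardExchange X 𝔅) (hsub : 𝔅 ⊆ basesOn X Finset.univ) {B : Finset (Fin N)}
    (hB : B ∈ 𝔅) {x : Fin N} (hx : x ∈ passiveSet X B) :
    ∃ b ∈ B, x < b ∧ insert x (B.erase b) ∈ 𝔅 := by
  classical
  obtain ⟨hxB, hact⟩ := mem_passiveSet.mp hx
  have hspan : X x ∉ Submodule.span ℝ (X '' {e : Fin N | e ∈ B ∧ e ≤ x}) :=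
    fun h => hact ⟨hxB, h⟩
  have hex : ∃ n : ℕ, X x ∈ Submodule.span ℝ (X '' {e : Fin N | e ∈ B ∧ e.val < n}) := by
    refine ⟨N, ?_⟩
    have : {e : Fin N | e ∈ B ∧ e.val < N} = (B : Set (Fin N)) := by
      ext e
      simp
    rw [this, (hsub hB).2.2]
    trivial
  obtain ⟨n, hn, hmin⟩ : ∃ n : ℕ,
      X x ∈ Submodule.span ℝ (X '' {e : Fin N | e ∈ B ∧ e.val < n}) ∧
      ∀ m < n, X x ∉ Submodule.span ℝ (X '' {e : Fin N | e ∈ B ∧ e.val < m}) :=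
    ⟨Nat.find hex, Nat.find_spec hex, fun m hm => Nat.find_min hex hm⟩
  have hlt : x.val + 1 < n := by
    by_contra hle
    have hss : {e : Fin N | e ∈ B ∧ e.val < n} ⊆ {e | e ∈ B ∧ e ≤ x} :=
      fun e he => ⟨he.1, Fin.le_def.mpr (by have := he.2; omega)⟩
    exact hspan (Submodule.span_mono (Set.image_mono hss) hn)
  obtain ⟨m, rfl⟩ : ∃ m, n = m + 1 := ⟨n - 1, by omega⟩
  have hm := hmin m (Nat.lt_succ_self m)
  obtain ⟨b, hbB, rfl⟩ : ∃ b ∈ B, b.val = m := by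
    by_contra hcon
    push Not at hcon
    have hss : {e : Fin N | e ∈ B ∧ e.val < m + 1} ⊆ {e | e ∈ B ∧ e.val < m} :=
      fun e he => ⟨he.1, by have h1 := hcon e he.1; have h2 := he.2; omega⟩
    exact hm (Submodule.span_mono (Set.image_mono hss) hn)
  refine ⟨b, hbB, by rw [Fin.lt_def]; omega, hfe B hB b hbB x ?_ hm hact⟩
  simpa only [Nat.lt_succ_iff, Fin.le_def] using hn

/-- Every product of affine forms indexed by a sublist is a combination of the deformed `Q_B`
of at most the same degree, modulo the deformed cocircuit ideal. -/
lemma affProd_mem_affFiltration {X : Fin N → Fin r → ℝ} (lam : Fin N → ℝ)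
    {𝔅 : Set (Finset (Fin N))} (hsub : 𝔅 ⊆ basesOn X Finset.univ) (hfe : forwardExchange X 𝔅)
    (Y : Finset (Fin N)) : affProd X lam Y ∈ affFiltration X lam 𝔅 (Y.card + 1) := by
  classical
  induction hw : ∑ y ∈ Y, (y.val + 1) using Nat.strong_induction_on generalizing Y with
  | _ w ih =>
  subst hw
  by_cases hT : ∀ B ∈ 𝔅, (Y ∩ B).Nonempty
  · exact affIdeal_le_affFiltration (Ideal.subset_span ⟨Y, hT, rfl⟩) _
  have hex : ({B | B ∈ 𝔅 ∧ Y ∩ B = ∅} : Set (Finset (Fin N))).Nonempty := by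
    push Not at hT
    exact hT
  obtain ⟨B, ⟨hB, hYB⟩, hmin⟩ := Set.exists_min_image _ (fun B => ∑ b ∈ B, b.val)
    (Set.toFinite _) hex
  have hdisj : ∀ y ∈ Y, y ∉ B := fun y hy hyB => by
    have := Finset.mem_inter.mpr ⟨hy, hyB⟩
    simp [hYB] at this
  have hpas : passiveSet X B ⊆ Y := by
    intro x hx
    by_contra hxY
    have hxB := (mem_passiveSet.mp hx).1
    obtain ⟨b, hbB, hxb, hB'⟩ := exists_forward_exchange hfe hsub hB hx
    have hle := hmin (insert x (B.erase b)) ⟨hB', by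
      refine Finset.eq_empty_of_forall_notMem fun y hy => ?_
      obtain ⟨hyY, hyB⟩ := Finset.mem_inter.mp hy
      rcases Finset.mem_insert.mp hyB with rfl | hyB
      · exact hxY hyY
      · exact hdisj y hyY (Finset.mem_of_mem_erase hyB)⟩
    have h1 : ∑ c ∈ insert x (B.erase b), c.val = x.val + ∑ c ∈ B.erase b, c.val :=
      Finset.sum_insert fun h => hxB (Finset.mem_of_mem_erase h)
    have h2 := Finset.add_sum_erase B (fun c : Fin N => c.val) hbB
    rw [Fin.lt_def] at hxb
    omega
  by_cases hY : Y ⊆ passiveSet X B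
  · rw [Finset.Subset.antisymm hY hpas]
    exact affProd_passiveSet_mem X lam hB (Nat.lt_succ_self _)
  obtain ⟨x, hxY, hxp⟩ := Finset.not_subset.mp hY
  have hact : isExtActive X B x := by
    by_contra hcon
    exact hxp (mem_passiveSet.mpr ⟨hdisj x hxY, hcon⟩)
  have hsum := Finset.add_sum_erase Y (fun c : Fin N => c.val + 1) hxY
  have hcard := Finset.card_erase_add_one hxY
  have herase : affProd X lam (Y.erase x) ∈ affFiltration X lam 𝔅 (Y.card + 1) :=
    affFiltration_mono X lam 𝔅 (by omega) (ih _ (by omega) (Y.erase x) rfl)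
  rw [← Finset.insert_erase hxY, affProd_insert X lam (Finset.notMem_erase x Y),
    Finset.insert_erase hxY]
  refine Submodule.sub_mem _ (linPoly_mul_mem ?_ hact.2) (Submodule.smul_mem _ _ herase)
  rintro _ ⟨b, ⟨hbB, hbx⟩, rfl⟩
  have hbY : b ∉ Y.erase x := fun h => hdisj b (Finset.mem_of_mem_erase h) hbB
  rw [linPoly_mul_affProd X lam hbY]
  refine Submodule.add_mem _ ?_ (Submodule.smul_mem _ _ herase)
  have hlt : b < x := lt_of_le_of_ne hbx fun h => hact.1 (h ▸ hbB)
  have h1 : ∑ c ∈ insert b (Y.erase x), (c.val + 1) =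
      (b.val + 1) + ∑ c ∈ Y.erase x, (c.val + 1) := Finset.sum_insert hbY
  have h2 := Finset.card_insert_of_notMem hbY
  rw [← hcard, ← h2]
  refine ih _ ?_ _ rfl
  rw [Fin.lt_def] at hlt
  omega

lemma linPoly_mul_mem_affFiltration {X : Fin N → Fin r → ℝ} (lam : Fin N → ℝ)
    {𝔅 : Set (Finset (Fin N))} (hsub : 𝔅 ⊆ basesOn X Finset.univ) (hfe : forwardExchange X 𝔅)
    (u : Fin r → ℝ) {k : ℕ} {f : MvPolynomial (Fin r) ℝ} (hf : f ∈ affFiltration X lam 𝔅 k) :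
    linPoly u * f ∈ affFiltration X lam 𝔅 (k + 1) := by
  classical
  suffices h : affFiltration X lam 𝔅 k ≤
      (affFiltration X lam 𝔅 (k + 1)).comap (LinearMap.mulLeft ℝ (linPoly u)) from h hf
  refine sup_le (Submodule.span_le.mpr ?_) fun g hg =>
    affIdeal_le_affFiltration (Ideal.mul_mem_left _ _ hg) _
  rintro _ ⟨B, ⟨hB, hk⟩, rfl⟩
  change linPoly u * affProd X lam (passiveSet X B) ∈ affFiltration X lam 𝔅 (k + 1)
  refine linPoly_mul_mem (s := X '' (B : Set (Fin N))) ?_ (by rw [(hsub hB).2.2]; trivial)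
  rintro _ ⟨b, hbB, rfl⟩
  have hb : b ∉ passiveSet X B := fun h => (mem_passiveSet.mp h).1 hbB
  rw [linPoly_mul_affProd X lam hb]
  refine Submodule.add_mem _ (affFiltration_mono X lam 𝔅 ?_
    (affProd_mem_affFiltration lam hsub hfe _))
    (Submodule.smul_mem _ _ (affProd_passiveSet_mem X lam hB (by omega)))
  rw [Finset.card_insert_of_notMem hb]
  omega

/-- The filtration by the deformed `Q_B` exhausts the filtration by degree. -/
lemma lowDegree_le_affFiltration {X : Fin N → Fin r → ℝ} (lam : Fin N → ℝ)
    {𝔅 : Set (Finset (Fin N))} (hsub : 𝔅 ⊆ basesOn X Finset.univ) (hfe : forwardExchange X 𝔅)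
    (k : ℕ) : lowDegree r k ≤ affFiltration X lam 𝔅 k := by
  classical
  suffices h : ∀ (n : ℕ) (m : Fin r →₀ ℕ), m.degree = n →
      MvPolynomial.monomial m (1 : ℝ) ∈ affFiltration X lam 𝔅 (n + 1) from
    lowDegree_le_of_monomial_mem fun m hm => affFiltration_mono X lam 𝔅 hm (h _ m rfl)
  intro n
  induction n with
  | zero =>
    intro m hm
    rw [(Finsupp.degree_eq_zero_iff m).mp hm]
    simpa [affProd] using affProd_mem_affFiltration lam hsub hfe (∅ : Finset (Fin N))
  | succ n ih =>
    intro m hm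
    obtain ⟨i, hi⟩ : ∃ i, m i ≠ 0 := by
      by_contra hcon
      push Not at hcon
      have : m = 0 := Finsupp.ext hcon
      simp [this] at hm
    have hle : Finsupp.single i 1 ≤ m := by
      rw [Finsupp.single_le_iff]
      omega
    have hm' : Finsupp.single i 1 + (m - Finsupp.single i 1) = m := add_tsub_cancel_of_le hle
    have hdeg : (m - Finsupp.single i 1).degree = n := by
      have := congrArg Finsupp.degree hm'
      rw [map_add, Finsupp.degree_single, hm] at this
      omega
    have hmul := linPoly_mul_mem_affFiltration lam hsub hfe (Pi.single i 1) (ih _ hdeg)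
    rw [linPoly_single, MvPolynomial.X, MvPolynomial.monomial_mul, hm', one_mul] at hmul
    exact hmul

end AffineDeformation

section Evaluation

variable {r N : ℕ}

lemma exists_dotProduct_eq {X : Fin N → Fin r → ℝ} (lam : Fin N → ℝ) {B : Finset (Fin N)}
    (hB : B ∈ basesOn X Finset.univ) : ∃ θ : Fin r → ℝ, ∀ b ∈ B, X b ⬝ᵥ θ = lam b := by
  obtain ⟨-, hli, hsp⟩ := hB
  have hsp' : ⊤ ≤ Submodule.span ℝ (Set.range fun b : (B : Set (Fin N)) => X b) := by
    rw [← hsp, Set.image_eq_range]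
  let 𝓑 := Module.Basis.mk hli hsp'
  let φ := 𝓑.constr ℝ fun b => lam b
  refine ⟨fun i => φ fun j => if i = j then 1 else 0, fun b hb => ?_⟩
  have h1 : φ (𝓑 ⟨b, hb⟩) = lam b := 𝓑.constr_basis ℝ _ _
  have h2 : 𝓑 ⟨b, hb⟩ = X b := Module.Basis.mk_apply hli hsp' _
  rw [← h1, h2, LinearMap.pi_apply_eq_sum_univ φ (X b)]
  simp [dotProduct]

lemma dotProduct_eq_zero_of_basis {X : Fin N → Fin r → ℝ} {B : Finset (Fin N)}
    (hB : B ∈ basesOn X Finset.univ) {θ : Fin r → ℝ} (h : ∀ b ∈ B, X b ⬝ᵥ θ = 0)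
    (u : Fin r → ℝ) : u ⬝ᵥ θ = 0 := by
  have hu : u ∈ Submodule.span ℝ (X '' (B : Set (Fin N))) := by
    rw [hB.2.2]
    trivial
  induction hu using Submodule.span_induction with
  | mem u hu =>
    obtain ⟨b, hb, rfl⟩ := hu
    exact h b hb
  | zero => exact zero_dotProduct θ
  | add u w _ _ hu hw => rw [add_dotProduct, hu, hw, add_zero]
  | smul c u _ hu => rw [smul_dotProduct, hu, smul_zero]

lemma card_of_mem_basesOn {X : Fin N → Fin r → ℝ} {B : Finset (Fin N)}
    (hB : B ∈ basesOn X Finset.univ) : B.card = r := by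
  obtain ⟨-, hli, hsp⟩ := hB
  have hsp' : ⊤ ≤ Submodule.span ℝ (Set.range fun b : (B : Set (Fin N)) => X b) := by
    rw [← hsp, Set.image_eq_range]
  have := Module.finrank_eq_card_basis (Module.Basis.mk hli hsp')
  simpa using this.symm

/-- The parameters for which the affine hyperplanes indexed by `T` have a common point. -/
def concurrentParams (X : Fin N → Fin r → ℝ) (T : Finset (Fin N)) :
    Submodule ℝ (Fin N → ℝ) where
  carrier := {lam | ∃ θ : Fin r → ℝ, ∀ i ∈ T, X i ⬝ᵥ θ = lam i}
  add_mem' := by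
    rintro lam mu ⟨θ, hθ⟩ ⟨η, hη⟩
    exact ⟨θ + η, fun i hi => by rw [dotProduct_add, hθ i hi, hη i hi, Pi.add_apply]⟩
  zero_mem' := ⟨0, fun i _ => dotProduct_zero _⟩
  smul_mem' := by
    rintro c lam ⟨θ, hθ⟩
    exact ⟨c • θ, fun i hi => by rw [dotProduct_smul, hθ i hi, Pi.smul_apply]⟩

lemma concurrentParams_union_ne_top {X : Fin N → Fin r → ℝ} {B B' : Finset (Fin N)}
    (hB : B ∈ basesOn X Finset.univ) (hB' : B' ∈ basesOn X Finset.univ) (hne : B ≠ B') :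
    concurrentParams X (B ∪ B') ≠ ⊤ := by
  intro htop
  obtain ⟨x, hx', hx⟩ : ∃ x ∈ B', x ∉ B := by
    by_contra hcon
    push Not at hcon
    refine hne (Finset.eq_of_subset_of_card_le hcon ?_).symm
    rw [card_of_mem_basesOn hB, card_of_mem_basesOn hB']
  have hmem : Pi.single x (1 : ℝ) ∈ concurrentParams X (B ∪ B') := by
    rw [htop]
    trivial
  obtain ⟨θ, hθ⟩ := hmem
  have hzero := dotProduct_eq_zero_of_basis hB (θ := θ) (fun b hb => by
    rw [hθ b (Finset.mem_union_left _ hb), Pi.single_eq_of_ne]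
    rintro rfl
    exact hx hb) (X x)
  rw [hθ x (Finset.mem_union_right _ hx'), Pi.single_eq_same] at hzero
  exact one_ne_zero hzero

/-- For generic parameters, the vertices of the arrangement of affine hyperplanes associated
with distinct bases are distinct. -/
lemma exists_generic_params {X : Fin N → Fin r → ℝ} :
    ∃ lam : Fin N → ℝ, ∀ B ∈ basesOn X Finset.univ, ∀ B' ∈ basesOn X Finset.univ,
      ∀ θ : Fin r → ℝ, (∀ b ∈ B, X b ⬝ᵥ θ = lam b) → (∀ b ∈ B', X b ⬝ᵥ θ = lam b) → B = B' := by
  classical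
  by_contra hcon
  push Not at hcon
  let ι := {p : Finset (Fin N) × Finset (Fin N) //
    p.1 ∈ basesOn X Finset.univ ∧ p.2 ∈ basesOn X Finset.univ ∧ p.1 ≠ p.2}
  have hcover : ⋃ p : ι, (concurrentParams X (p.1.1 ∪ p.1.2) : Set (Fin N → ℝ)) = Set.univ := by
    refine Set.eq_univ_of_forall fun lam => ?_
    obtain ⟨B, hB, B', hB', θ, h, h', hne⟩ := hcon lam
    refine Set.mem_iUnion.mpr ⟨⟨(B, B'), hB, hB', hne⟩, θ, fun i hi => ?_⟩
    exact (Finset.mem_union.mp hi).elim (h i) (h' i)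
  obtain ⟨p, hp⟩ := Subspace.exists_eq_top_of_iUnion_eq_univ hcover
  exact concurrentParams_union_ne_top p.2.1 p.2.2.1 p.2.2.2 hp

/-- Evaluation of polynomials at a family of points. -/
noncomputable def evalAt {ι : Type*} (θ : ι → Fin r → ℝ) :
    MvPolynomial (Fin r) ℝ →ₗ[ℝ] ι → ℝ :=
  LinearMap.pi fun a => (MvPolynomial.aeval (θ a)).toLinearMap

lemma evalAt_apply {ι : Type*} (θ : ι → Fin r → ℝ) (f : MvPolynomial (Fin r) ℝ) (a : ι) :
    evalAt θ f a = MvPolynomial.eval (θ a) f := by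
  simp [evalAt, MvPolynomial.aeval_eq_eval]

lemma evalAt_surjective {ι : Type*} [Finite ι] {θ : ι → Fin r → ℝ}
    (hθ : Function.Injective θ) : Function.Surjective (evalAt θ) := by
  classical
  have := Fintype.ofFinite ι
  have hsep : ∀ a b : ι, ∃ g : MvPolynomial (Fin r) ℝ, a ≠ b →
      MvPolynomial.eval (θ a) g = 1 ∧ MvPolynomial.eval (θ b) g = 0 := by
    intro a b
    by_cases hab : a = b
    · exact ⟨0, fun h => absurd hab h⟩
    obtain ⟨i, hi⟩ := Function.ne_iff.mp (hθ.ne hab)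
    refine ⟨MvPolynomial.C (θ a i - θ b i)⁻¹ *
      (MvPolynomial.X i - MvPolynomial.C (θ b i)), fun _ => ⟨?_, ?_⟩⟩
    · simp [inv_mul_cancel₀ (sub_ne_zero.mpr hi)]
    · simp
  choose g hg using hsep
  intro c
  refine ⟨∑ a, c a • ∏ b ∈ Finset.univ.erase a, g a b, ?_⟩
  ext d
  rw [evalAt_apply, map_sum, Finset.sum_eq_single d]
  · rw [MvPolynomial.smul_eval, map_prod, Finset.prod_eq_one, mul_one]
    intro b hb
    exact (hg d b (Finset.ne_of_mem_erase hb).symm).1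
  · intro a _ had
    rw [MvPolynomial.smul_eval, map_prod, Finset.prod_eq_zero (i := d), mul_zero]
    · exact Finset.mem_erase.mpr ⟨had.symm, Finset.mem_univ d⟩
    · exact (hg a d had).2
  · simp

lemma eval_eq_zero_of_mem_affIdeal {X : Fin N → Fin r → ℝ} {lam : Fin N → ℝ}
    {𝔅 : Set (Finset (Fin N))} {B : Finset (Fin N)} (hB : B ∈ 𝔅) {θ : Fin r → ℝ}
    (hθ : ∀ b ∈ B, X b ⬝ᵥ θ = lam b) {f : MvPolynomial (Fin r) ℝ} (hf : f ∈ affIdeal X lam 𝔅) :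
    MvPolynomial.eval θ f = 0 := by
  suffices h : affIdeal X lam 𝔅 ≤ RingHom.ker (MvPolynomial.eval θ) from RingHom.mem_ker.mp (h hf)
  refine Ideal.span_le.mpr ?_
  rintro _ ⟨C, hC, rfl⟩
  obtain ⟨b, hb⟩ := hC B hB
  obtain ⟨hbC, hbB⟩ := Finset.mem_inter.mp hb
  refine RingHom.mem_ker.mpr ?_
  rw [affProd, map_prod]
  refine Finset.prod_eq_zero hbC ?_
  rw [map_sub, eval_linPoly, hθ b hbB, MvPolynomial.eval_C, sub_self]

/-- There are parameters for which the deformed `Q_B` are linearly independent modulo the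
deformed cocircuit ideal, as witnessed by a linear map killing the latter. -/
lemma exists_linearIndepOn_affProd {X : Fin N → Fin r → ℝ} {𝔅 : Set (Finset (Fin N))}
    (hsub : 𝔅 ⊆ basesOn X Finset.univ) (hfe : forwardExchange X 𝔅) :
    ∃ (lam : Fin N → ℝ) (ev : MvPolynomial (Fin r) ℝ →ₗ[ℝ] 𝔅 → ℝ),
      (∀ f ∈ affIdeal X lam 𝔅, ev f = 0) ∧
      LinearIndepOn ℝ (fun B => ev (affProd X lam (passiveSet X B))) 𝔅 := by
  classical
  obtain ⟨lam, hlam⟩ := exists_generic_params (X := X)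
  choose θ hθ using fun B : 𝔅 => exists_dotProduct_eq lam (hsub B.2)
  have hinj : Function.Injective θ := fun B B' h =>
    Subtype.ext (hlam B (hsub B.2) B' (hsub B'.2) (θ B) (hθ B) (h ▸ hθ B'))
  have hker : ∀ f ∈ affIdeal X lam 𝔅, evalAt θ f = 0 := fun f hf => by
    ext B
    rw [evalAt_apply]
    exact eval_eq_zero_of_mem_affIdeal B.2 (hθ B) hf
  refine ⟨lam, evalAt θ, hker, ?_⟩
  have := Fintype.ofFinite 𝔅
  refine linearIndependent_of_top_le_span_of_card_eq_finrank ?_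
    (Module.finrank_fintype_fun_eq_card ℝ).symm
  rintro c -
  obtain ⟨f, rfl⟩ := evalAt_surjective hinj c
  have hf : f ∈ affFiltration X lam 𝔅 (f.totalDegree + 1) := by
    refine lowDegree_le_affFiltration lam hsub hfe _ fun m hm => ?_
    exact MvPolynomial.coeff_eq_zero_of_totalDegree_lt (Nat.lt_of_succ_le hm)
  suffices h : affFiltration X lam 𝔅 (f.totalDegree + 1) ≤
      (Submodule.span ℝ (Set.range fun B : 𝔅 =>
        evalAt θ (affProd X lam (passiveSet X B)))).comap (evalAt θ) from h hf
  refine sup_le (Submodule.span_le.mpr ?_) fun g hg => ?_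
  · rintro _ ⟨B, ⟨hB, -⟩, rfl⟩
    exact Submodule.subset_span ⟨⟨B, hB⟩, rfl⟩
  · rw [Submodule.mem_comap, hker g hg]
    exact Submodule.zero_mem _

end Evaluation

section CocircuitIdeal

variable {r N : ℕ}

lemma Jideal_eq (X : Fin N → Fin r → ℝ) (𝔅 : Set (Finset (Fin N))) :
    Jideal X Finset.univ 𝔅 = affIdeal X 0 𝔅 := by
  refine le_antisymm (Ideal.span_le.mpr ?_) (Ideal.span_le.mpr ?_)
  · rintro _ ⟨C, hC, rfl⟩
    exact Ideal.subset_span ⟨C, hC.2.1, (affProd_zero X C).symm⟩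
  · rintro _ ⟨C, hC, rfl⟩
    obtain ⟨D, hDC, hD⟩ := (Set.toFinite {D : Finset (Fin N) | ∀ B ∈ 𝔅, (D ∩ B).Nonempty}
      ).exists_le_minimal hC
    have hmem : prodPoly X D ∈ Jideal X Finset.univ 𝔅 := by
      refine Ideal.subset_span ⟨D, ⟨Finset.subset_univ D, hD.1, fun D' hD' h => ?_⟩, rfl⟩
      exact Finset.Subset.antisymm hD' (hD.2 h hD')
    rw [affProd_zero]
    exact Ideal.mem_of_dvd _ (Finset.prod_dvd_prod_of_subset D C _ hDC) hmem

/-- The cocircuit ideal is homogeneous, and consists of leading forms of elements of its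
deformations. -/
lemma homogeneousComponent_mem_and_exists_lift {X : Fin N → Fin r → ℝ} (lam : Fin N → ℝ)
    {𝔅 : Set (Finset (Fin N))} {f : MvPolynomial (Fin r) ℝ} (hf : f ∈ affIdeal X 0 𝔅) (k : ℕ) :
    MvPolynomial.homogeneousComponent k f ∈ affIdeal X 0 𝔅 ∧
      ∃ g ∈ affIdeal X lam 𝔅, MvPolynomial.homogeneousComponent k f - g ∈ lowDegree r k := by
  have hadd : ∀ f₁ f₂ : MvPolynomial (Fin r) ℝ,
      (MvPolynomial.homogeneousComponent k f₁ ∈ affIdeal X 0 𝔅 ∧ ∃ g ∈ affIdeal X lam 𝔅,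
        MvPolynomial.homogeneousComponent k f₁ - g ∈ lowDegree r k) →
      (MvPolynomial.homogeneousComponent k f₂ ∈ affIdeal X 0 𝔅 ∧ ∃ g ∈ affIdeal X lam 𝔅,
        MvPolynomial.homogeneousComponent k f₂ - g ∈ lowDegree r k) →
      (MvPolynomial.homogeneousComponent k (f₁ + f₂) ∈ affIdeal X 0 𝔅 ∧ ∃ g ∈ affIdeal X lam 𝔅,
        MvPolynomial.homogeneousComponent k (f₁ + f₂) - g ∈ lowDegree r k) := by
    rintro f₁ f₂ ⟨h₁, g₁, hg₁, hd₁⟩ ⟨h₂, g₂, hg₂, hd₂⟩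
    rw [map_add]
    refine ⟨add_mem h₁ h₂, g₁ + g₂, add_mem hg₁ hg₂, ?_⟩
    rw [add_sub_add_comm]
    exact add_mem hd₁ hd₂
  have hzero : (MvPolynomial.homogeneousComponent k (0 : MvPolynomial (Fin r) ℝ) ∈
      affIdeal X 0 𝔅 ∧ ∃ g ∈ affIdeal X lam 𝔅,
        MvPolynomial.homogeneousComponent k (0 : MvPolynomial (Fin r) ℝ) - g ∈ lowDegree r k) := by
    rw [map_zero]
    exact ⟨zero_mem _, 0, zero_mem _, by rw [sub_zero]; exact zero_mem _⟩
  induction hf using Submodule.closure_induction with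
  | zero => exact hzero
  | add f₁ f₂ _ _ h₁ h₂ => exact hadd f₁ f₂ h₁ h₂
  | smul_mem a p hp =>
    obtain ⟨C, hC, rfl⟩ := hp
    induction a using MvPolynomial.induction_on' with
    | add a b ha hb =>
      rw [add_smul]
      exact hadd _ _ ha hb
    | monomial m c =>
      have hmon : (MvPolynomial.monomial m c).IsHomogeneous m.degree :=
        MvPolynomial.isHomogeneous_monomial c rfl
      rw [smul_eq_mul, affProd_zero, MvPolynomial.homogeneousComponent_of_mem
        (hmon.mul (isHomogeneous_prodPoly X C))]
      split_ifs with hk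
      · refine ⟨Ideal.mul_mem_left _ _ (Ideal.subset_span ⟨C, hC, (affProd_zero X C).symm⟩),
          MvPolynomial.monomial m c * affProd X lam C,
          Ideal.mul_mem_left _ _ (Ideal.subset_span ⟨C, hC, rfl⟩), ?_⟩
        rw [← mul_sub, hk]
        refine isHomogeneous_mul_mem_lowDegree hmon ?_
        rw [← neg_sub]
        exact neg_mem (affProd_sub_prodPoly_mem X lam C)
      · rw [map_zero] at hzero
        exact hzero

/-- The `Q_B` of a given degree are linearly independent modulo the cocircuit ideal. -/
lemma linearIndepOn_mkQ_prodPoly {X : Fin N → Fin r → ℝ} {𝔅 : Set (Finset (Fin N))}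
    (hsub : 𝔅 ⊆ basesOn X Finset.univ) (hfe : forwardExchange X 𝔅) (k : ℕ) :
    LinearIndepOn ℝ (((affIdeal X 0 𝔅).restrictScalars ℝ).mkQ ∘
      fun B => prodPoly X (passiveSet X B)) {B | B ∈ 𝔅 ∧ (passiveSet X B).card = k} := by
  classical
  obtain ⟨lam, ev, hker, hli⟩ := exists_linearIndepOn_affProd hsub hfe
  have hdisj : Disjoint {B | B ∈ 𝔅 ∧ (passiveSet X B).card = k}
      {B | B ∈ 𝔅 ∧ (passiveSet X B).card < k} :=
    Set.disjoint_left.mpr fun B h h' => h'.2.ne h.2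
  obtain ⟨hlik, -, hspan⟩ := (linearIndepOn_union_iff hdisj).mp
    (hli.mono (Set.union_subset (fun B h => h.1) fun B h => h.1))
  rw [linearIndepOn_iff] at hlik ⊢
  intro l hl hl0
  refine hlik l hl ?_
  set f := Finsupp.linearCombination ℝ (fun B => prodPoly X (passiveSet X B)) l with hf
  set fl := Finsupp.linearCombination ℝ (fun B => affProd X lam (passiveSet X B)) l with hfl
  have hev : ev fl = Finsupp.linearCombination ℝ
      (fun B => ev (affProd X lam (passiveSet X B))) l :=
    Finsupp.apply_linearCombination ℝ ev _ l
  rw [← hev]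
  have hcard : ∀ B ∈ l.support, (passiveSet X B).card = k := fun B hB => (hl hB).2
  have hfJ : f ∈ affIdeal X 0 𝔅 := by
    rw [← Finsupp.apply_linearCombination, Submodule.mkQ_apply,
      Submodule.Quotient.mk_eq_zero] at hl0
    exact hl0
  have hfk : f.IsHomogeneous k := by
    rw [hf, Finsupp.linearCombination_apply]
    refine Submodule.sum_mem (MvPolynomial.homogeneousSubmodule (Fin r) ℝ k) fun B hB => ?_
    refine Submodule.smul_mem _ _ ?_
    rw [← hcard B hB]
    exact isHomogeneous_prodPoly X _
  have hdiff : fl - f ∈ lowDegree r k := by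
    rw [hf, hfl, Finsupp.linearCombination_apply, Finsupp.linearCombination_apply,
      Finsupp.sum, Finsupp.sum, ← Finset.sum_sub_distrib]
    refine Submodule.sum_mem _ fun B hB => ?_
    rw [← smul_sub, ← hcard B hB]
    exact Submodule.smul_mem _ _ (affProd_sub_prodPoly_mem X lam _)
  obtain ⟨-, g, hg, hfg⟩ := homogeneousComponent_mem_and_exists_lift lam hfJ k
  rw [MvPolynomial.homogeneousComponent_eq_self hfk] at hfg
  have hlow : fl - g ∈ affFiltration X lam 𝔅 k :=
    lowDegree_le_affFiltration lam hsub hfe k (by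
      rw [← sub_add_sub_cancel fl f g]
      exact add_mem hdiff hfg)
  have hsmall : affFiltration X lam 𝔅 k ≤ (Submodule.span ℝ
      ((fun B => ev (affProd X lam (passiveSet X B))) ''
        {B | B ∈ 𝔅 ∧ (passiveSet X B).card < k})).comap ev := by
    refine sup_le (Submodule.span_le.mpr ?_) fun q hq => ?_
    · rintro _ ⟨B, hB, rfl⟩
      exact Submodule.subset_span ⟨B, hB, rfl⟩
    · rw [Submodule.mem_comap, hker q hq]
      exact Submodule.zero_mem _
  have h1 := hsmall hlow
  rw [Submodule.mem_comap, map_sub, hker g hg, sub_zero] at h1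
  refine Submodule.disjoint_def.mp hspan _ ?_ h1
  rw [hev]
  exact Finsupp.mem_span_image_iff_linearCombination ℝ |>.mpr ⟨l, hl, rfl⟩

end CocircuitIdeal

section Pairing

variable {r : ℕ}

lemma pairing_comm (p f : MvPolynomial (Fin r) ℝ) : pairing p f = pairing f p := by
  classical
  have key : ∀ p f : MvPolynomial (Fin r) ℝ, pairing p f =
      ∑ α ∈ p.support ∪ f.support, (∏ i, ((α i).factorial : ℝ)) * p.coeff α * f.coeff α := by
    intro p f
    refine Finset.sum_subset Finset.subset_union_left fun α _ hα => ?_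
    rw [MvPolynomial.notMem_support_iff.mp hα, mul_zero, zero_mul]
  rw [key p f, key f p, Finset.union_comm]
  exact Finset.sum_congr rfl fun α _ => by ring

/-- The pairing with a fixed second argument, as a linear form in the first argument. -/
noncomputable def pairingLeft (f : MvPolynomial (Fin r) ℝ) : MvPolynomial (Fin r) ℝ →ₗ[ℝ] ℝ where
  toFun q := pairing q f
  map_add' p q := by rw [pairing_comm, pairing_add, pairing_comm f p, pairing_comm f q]
  map_smul' c q := by
    rw [pairing_comm, pairing_smul, pairing_comm f q, RingHom.id_apply, smul_eq_mul]

lemma pairing_monomial_one (m : Fin r →₀ ℕ) (f : MvPolynomial (Fin r) ℝ) :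
    pairing (MvPolynomial.monomial m 1) f = (∏ i, ((m i).factorial : ℝ)) * f.coeff m := by
  classical
  simp [pairing, MvPolynomial.support_monomial]

lemma prod_factorial_ne_zero (m : Fin r →₀ ℕ) : (∏ i, ((m i).factorial : ℝ)) ≠ 0 :=
  Finset.prod_ne_zero_iff.mpr fun _ _ => Nat.cast_ne_zero.mpr (Nat.factorial_ne_zero _)

lemma eq_zero_of_forall_pairing_eq_zero {f : MvPolynomial (Fin r) ℝ}
    (h : ∀ q, pairing q f = 0) : f = 0 := by
  ext m
  have := h (MvPolynomial.monomial m 1)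
  rw [pairing_monomial_one] at this
  exact (mul_eq_zero.mp this).resolve_left (prod_factorial_ne_zero m)

lemma linearMap_ext_monomial_one {φ ψ : MvPolynomial (Fin r) ℝ →ₗ[ℝ] ℝ}
    (h : ∀ m, φ (MvPolynomial.monomial m 1) = ψ (MvPolynomial.monomial m 1)) : φ = ψ := by
  refine LinearMap.ext fun q => ?_
  induction q using MvPolynomial.induction_on' with
  | monomial m c =>
    rw [← mul_one c, ← smul_eq_mul, ← MvPolynomial.smul_monomial, map_smul, map_smul, h m]
  | add p q hp hq => rw [map_add, map_add, hp, hq]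

lemma pairing_eq_zero_of_isHomogeneous {j k : ℕ} (hjk : j ≠ k) {q f : MvPolynomial (Fin r) ℝ}
    (hq : q.IsHomogeneous j) (hf : f.IsHomogeneous k) : pairing q f = 0 := by
  refine Finset.sum_eq_zero fun α _ => ?_
  by_cases h : α.degree = j
  · rw [hf.coeff_eq_zero (h.trans_ne hjk), mul_zero]
  · rw [hq.coeff_eq_zero h, mul_zero, zero_mul]

/-- Every linear form is represented in degree `k` by pairing with a homogeneous polynomial. -/
lemma exists_pairing_eq (ψ : MvPolynomial (Fin r) ℝ →ₗ[ℝ] ℝ) (k : ℕ) :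
    ∃ f : MvPolynomial (Fin r) ℝ, f.IsHomogeneous k ∧
      ∀ q, pairing q f = ψ (MvPolynomial.homogeneousComponent k q) := by
  classical
  let f : MvPolynomial (Fin r) ℝ := ∑ m ∈ Finset.finsuppAntidiag Finset.univ k,
    MvPolynomial.monomial m (ψ (MvPolynomial.monomial m 1) / ∏ i, ((m i).factorial : ℝ))
  have hmem : ∀ m : Fin r →₀ ℕ, m ∈ Finset.finsuppAntidiag Finset.univ k ↔ m.degree = k := by
    intro m
    simp [Finset.mem_finsuppAntidiag, Finsupp.degree_eq_sum]
  have hcoeff : ∀ m : Fin r →₀ ℕ, f.coeff m = if m.degree = k then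
      ψ (MvPolynomial.monomial m 1) / ∏ i, ((m i).factorial : ℝ) else 0 := by
    intro m
    simp only [f, MvPolynomial.coeff_sum, MvPolynomial.coeff_monomial]
    rw [Finset.sum_ite_eq' (Finset.finsuppAntidiag Finset.univ k) m]
    simp only [hmem]
  refine ⟨f, ?_, fun q => ?_⟩
  · refine MvPolynomial.IsHomogeneous.sum _ _ _ fun m hm => ?_
    exact MvPolynomial.isHomogeneous_monomial _ ((hmem m).mp hm)
  · refine LinearMap.congr_fun (f := pairingLeft f)
      (g := ψ ∘ₗ MvPolynomial.homogeneousComponent k) (linearMap_ext_monomial_one fun m => ?_) q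
    change pairing (MvPolynomial.monomial m 1) f =
      ψ (MvPolynomial.homogeneousComponent k (MvPolynomial.monomial m 1))
    rw [pairing_monomial_one, hcoeff, MvPolynomial.homogeneousComponent_of_mem
      (MvPolynomial.isHomogeneous_monomial (1 : ℝ) rfl)]
    by_cases h : m.degree = k
    · rw [if_pos h, if_pos h.symm, mul_div_cancel₀ _ (prod_factorial_ne_zero m)]
    · rw [if_neg h, if_neg (Ne.symm h), mul_zero, map_zero]

end Pairing

section HilbertSeries

variable {r N : ℕ}

lemma card_passiveSet_eq_iff {X : Fin N → Fin r → ℝ} {B : Finset (Fin N)}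
    (hB : B ∈ basesOn X Finset.univ) (k : ℕ) :
    (passiveSet X B).card = k ↔
      ((extSetOn X Finset.univ B).card : ℤ) = (N : ℤ) - r - k := by
  classical
  have hdisj : Disjoint B (extSetOn X Finset.univ B) :=
    Finset.disjoint_left.mpr fun b hb hE => (Finset.mem_filter.mp hE).2.1 hb
  have h1 : (passiveSet X B).card + (B ∪ extSetOn X Finset.univ B).card = N := by
    rw [passiveSet, Finset.card_sdiff_add_card_eq_card (Finset.subset_univ _), Finset.card_univ,
      Fintype.card_fin]
  rw [Finset.card_union_of_disjoint hdisj, card_of_mem_basesOn hB] at h1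
  omega

lemma PspaceB_inf_homogeneousSubmodule (X : Fin N → Fin r → ℝ) (𝔅 : Set (Finset (Fin N)))
    (k : ℕ) :
    PspaceB X Finset.univ 𝔅 ⊓ MvPolynomial.homogeneousSubmodule (Fin r) ℝ k =
      Submodule.span ℝ (Set.range fun B : {B | B ∈ 𝔅 ∧ (passiveSet X B).card = k} =>
        prodPoly X (passiveSet X B)) := by
  refine le_antisymm ?_ (Submodule.span_le.mpr ?_)
  · rintro f ⟨hfP, hfk⟩
    rw [← MvPolynomial.homogeneousComponent_eq_self hfk]
    suffices h : PspaceB X Finset.univ 𝔅 ≤ (Submodule.span ℝ (Set.range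
        fun B : {B | B ∈ 𝔅 ∧ (passiveSet X B).card = k} => prodPoly X (passiveSet X B))).comap
        (MvPolynomial.homogeneousComponent k) from h hfP
    refine Submodule.span_le.mpr ?_
    rintro _ ⟨B, hB, rfl⟩
    rw [QB_eq, SetLike.mem_coe, Submodule.mem_comap,
      MvPolynomial.homogeneousComponent_of_mem (isHomogeneous_prodPoly X _)]
    split_ifs with hk
    · exact Submodule.subset_span ⟨⟨B, hB, hk.symm⟩, rfl⟩
    · exact Submodule.zero_mem _
  · rintro _ ⟨⟨B, hB, hk⟩, rfl⟩
    refine ⟨Submodule.subset_span ⟨B, hB, rfl⟩, ?_⟩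
    have := isHomogeneous_prodPoly X (passiveSet X B)
    rwa [hk] at this

lemma finrank_PspaceB {X : Fin N → Fin r → ℝ} {𝔅 : Set (Finset (Fin N))}
    (hsub : 𝔅 ⊆ basesOn X Finset.univ) (hfe : forwardExchange X 𝔅) (k : ℕ) :
    Module.finrank ℝ
        ↥(PspaceB X Finset.univ 𝔅 ⊓ MvPolynomial.homogeneousSubmodule (Fin r) ℝ k) =
      Set.ncard {B | B ∈ 𝔅 ∧ (passiveSet X B).card = k} := by
  have := Fintype.ofFinite {B | B ∈ 𝔅 ∧ (passiveSet X B).card = k}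
  have hli : LinearIndependent ℝ fun B : {B | B ∈ 𝔅 ∧ (passiveSet X B).card = k} =>
      prodPoly X (passiveSet X B) :=
    LinearIndependent.of_comp _ (linearIndepOn_mkQ_prodPoly hsub hfe k)
  rw [PspaceB_inf_homogeneousSubmodule, finrank_span_eq_card hli, ← Nat.card_eq_fintype_card,
    Nat.card_coe_set_eq]

lemma finrank_Dspace {X : Fin N → Fin r → ℝ} {𝔅 : Set (Finset (Fin N))}
    (hsub : 𝔅 ⊆ basesOn X Finset.univ) (hfe : forwardExchange X 𝔅) (k : ℕ) :
    Module.finrank ℝ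
        ↥(Dspace X Finset.univ 𝔅 ⊓ MvPolynomial.homogeneousSubmodule (Fin r) ℝ k) =
      Set.ncard {B | B ∈ 𝔅 ∧ (passiveSet X B).card = k} := by
  have := Fintype.ofFinite {B | B ∈ 𝔅 ∧ (passiveSet X B).card = k}
  have hmemD : ∀ f, f ∈ Dspace X Finset.univ 𝔅 ↔ ∀ q ∈ affIdeal X 0 𝔅, pairing q f = 0 := by
    intro f
    rw [← Jideal_eq]
    exact Iff.rfl
  let Φ : ↥(Dspace X Finset.univ 𝔅 ⊓ MvPolynomial.homogeneousSubmodule (Fin r) ℝ k) →ₗ[ℝ]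
      ({B | B ∈ 𝔅 ∧ (passiveSet X B).card = k} → ℝ) :=
    { toFun := fun f B => pairing (prodPoly X (passiveSet X B)) f
      map_add' := fun f g => funext fun B => pairing_add _ _ _
      map_smul' := fun c f => funext fun B => pairing_smul _ _ _ }
  have hinj : Function.Injective Φ := by
    refine (injective_iff_map_eq_zero Φ).mpr ?_
    rintro ⟨f, hfD, hfk⟩ hf
    refine Subtype.ext (eq_zero_of_forall_pairing_eq_zero fun q => ?_)
    have hq : q ∈ affFiltration X 0 𝔅 (q.totalDegree + 1) := by
      refine lowDegree_le_affFiltration 0 hsub hfe _ fun m hm => ?_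
      exact MvPolynomial.coeff_eq_zero_of_totalDegree_lt (Nat.lt_of_succ_le hm)
    suffices h : affFiltration X 0 𝔅 (q.totalDegree + 1) ≤ (pairingLeft f).ker from
      LinearMap.mem_ker.mp (h hq)
    refine sup_le (Submodule.span_le.mpr ?_) fun g hg => (hmemD f).mp hfD g hg
    rintro _ ⟨B, ⟨hB, -⟩, rfl⟩
    change pairing (affProd X 0 (passiveSet X B)) f = 0
    rw [affProd_zero]
    by_cases hk : (passiveSet X B).card = k
    · exact congrFun hf ⟨B, hB, hk⟩
    · exact pairing_eq_zero_of_isHomogeneous hk (isHomogeneous_prodPoly X _) hfk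
  have hsurj : Function.Surjective Φ := by
    intro c
    have hli := (linearIndepOn_mkQ_prodPoly hsub hfe k).linearIndependent
    obtain ⟨ψ, hψ⟩ := LinearMap.exists_extend ((Module.Basis.span hli).constr ℝ c)
    obtain ⟨f, hfk, hf⟩ := exists_pairing_eq
      (ψ ∘ₗ ((affIdeal X 0 𝔅).restrictScalars ℝ).mkQ) k
    refine ⟨⟨f, (hmemD f).mpr fun q hq => ?_, hfk⟩, funext fun B => ?_⟩
    · rw [hf, LinearMap.comp_apply, Submodule.mkQ_apply,
        (Submodule.Quotient.mk_eq_zero ((affIdeal X 0 𝔅).restrictScalars ℝ)).mpr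
          (homogeneousComponent_mem_and_exists_lift 0 hq k).1, map_zero]
    · have hB := isHomogeneous_prodPoly X (passiveSet X B)
      rw [B.2.2] at hB
      change pairing (prodPoly X (passiveSet X B)) f = c B
      rw [hf, MvPolynomial.homogeneousComponent_eq_self hB, LinearMap.comp_apply]
      have h1 := (Module.Basis.span hli).constr_basis ℝ c B
      rw [← hψ, LinearMap.comp_apply, Submodule.subtype_apply, Module.Basis.span_apply] at h1
      exact h1
  rw [(LinearEquiv.ofBijective Φ ⟨hinj, hsurj⟩).finrank_eq, Module.finrank_fintype_fun_eq_card,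
    ← Nat.card_eq_fintype_card, Nat.card_coe_set_eq]

end HilbertSeries

/-- for `𝔅'` with the forward exchange property, the Hilbert series
of `𝒫(X,𝔅')` and `𝒟(X,𝔅')` agree and are counted by external activity. -/
theorem statement12 {r N : ℕ} (X : Fin N → Fin r → ℝ)
    (hX : Submodule.span ℝ (Set.range X) = ⊤)
    (𝔅' : Set (Finset (Fin N))) (hne : 𝔅'.Nonempty)
    (hsub : 𝔅' ⊆ basesOn X Finset.univ)
    (hfe : forwardExchange X 𝔅') (k : ℕ) :
    Module.finrank ℝ
        ↥(PspaceB X Finset.univ 𝔅' ⊓ MvPolynomial.homogeneousSubmodule (Fin r) ℝ k)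
      = Set.ncard {B ∈ 𝔅' |
          ((extSetOn X Finset.univ B).card : ℤ) = (N : ℤ) - r - k} ∧
    Module.finrank ℝ
        ↥(Dspace X Finset.univ 𝔅' ⊓ MvPolynomial.homogeneousSubmodule (Fin r) ℝ k)
      = Set.ncard {B ∈ 𝔅' |
          ((extSetOn X Finset.univ B).card : ℤ) = (N : ℤ) - r - k} := by
  have hset : {B ∈ 𝔅' | ((extSetOn X Finset.univ B).card : ℤ) = (N : ℤ) - r - k} =
      {B | B ∈ 𝔅' ∧ (passiveSet X B).card = k} :=
    Set.ext fun B => and_congr_right fun hB => (card_passiveSet_eq_iff (hsub hB) k).symm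
  rw [hset]
  exact ⟨finrank_PspaceB hsub hfe k, finrank_Dspace hsub hfe k⟩
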